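/- For every integer ℓ ≥ 3 there exists a constant c > 0 such that for every field F and every integer n ≥ 1, every graph G on n vertices whose complement is C_ℓ-free satisfies minrk_F(G) ≤ c · n^{1/k}, where k = ⌈ℓ/2⌉. -/

import Mathlib

open Matrix

/-- `M` represents the graph `G` over a field: nonzero diagonal entries, and zero entries at
off-diagonal non-adjacent pairs. -/
def Represents {F V : Type*} [Field F] (M : Matrix V V F) (G : SimpleGraph V) : Prop :=
  (∀ v, M v v ≠ 0) ∧ ∀ u v, u ≠ v → ¬ G.Adj u v → M u v = 0

/-- The minrank of a graph `G` over a field `F`: the minimum possible rank of a matrix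
representing `G`. -/
noncomputable def minrk (F : Type*) [Field F] {V : Type*} [Fintype V]
    (G : SimpleGraph V) : ℕ :=
  sInf { r : ℕ | ∃ M : Matrix V V F, Represents M G ∧ M.rank = r }

/-- `G` contains a copy of `H` as a (not necessarily induced) subgraph, i.e. there is an
injective graph homomorphism from `H` to `G`. -/
def ContainsCopy {V W : Type*} (H : SimpleGraph W) (G : SimpleGraph V) : Prop :=
  ∃ f : W → V, Function.Injective f ∧ ∀ a b, H.Adj a b → G.Adj (f a) (f b)
open Finset

/-- A relation without chains of length `N` admits a proper colouring with `N` colours. -/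
lemma exists_coloring_of_no_chain {V : Type*} (R : V → V → Prop) (N : ℕ)
    (hR : ¬ ∃ p : ℕ → V, ∀ t < N, R (p t) (p (t + 1))) :
    ∃ c : V → Fin N, ∀ x y, R x y → c x ≠ c y := by
  classical
  let P : V → ℕ → Prop := fun x m => ∃ p : ℕ → V, p 0 = x ∧ ∀ t < m, R (p t) (p (t + 1))
  have hP : ∀ x m, P x m → m < N := by
    rintro x m ⟨p, -, hp⟩
    by_contra! h
    exact hR ⟨p, fun t ht => hp t (by omega)⟩
  have hP0 : ∀ x, P x 0 := fun x => ⟨fun _ => x, rfl, by simp⟩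
  have hg : ∀ x, P x (Nat.findGreatest (P x) N) := fun x =>
    Nat.findGreatest_spec (Nat.zero_le N) (hP0 x)
  refine ⟨fun x => ⟨Nat.findGreatest (P x) N, hP x _ (hg x)⟩, fun x y hxy h => ?_⟩
  rw [Fin.mk.injEq] at h
  obtain ⟨p, hp0, hp⟩ := hg y
  have hx : P x (Nat.findGreatest (P y) N + 1) := by
    refine ⟨fun t => if t = 0 then x else p (t - 1), by simp, fun t ht => ?_⟩
    rcases t with _ | t
    · simpa [hp0] using hxy
    · simpa using hp t (by omega)
  have := Nat.le_findGreatest (hP x _ hx).le hx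
  omega

lemma containsCopy_cycleGraph {V : Type*} (H : SimpleGraph V) (ℓ : ℕ) (f : ℕ → V)
    (hinj : ∀ a b, a < b → b < ℓ → f a ≠ f b)
    (hadj : ∀ a, a + 1 < ℓ → H.Adj (f a) (f (a + 1))) (hclose : H.Adj (f (ℓ - 1)) (f 0)) :
    ContainsCopy (SimpleGraph.cycleGraph ℓ) H := by
  have key : ∀ a b : Fin ℓ, (b - a).val = 1 → H.Adj (f a) (f b) := by
    intro a b h
    rw [Fin.sub_def] at h
    have ha := a.isLt
    have hb := b.isLt
    simp only at h
    by_cases hab : a.val ≤ b.val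
    · rw [show ℓ - a.val + b.val = (b.val - a.val) + ℓ by omega, Nat.add_mod_right,
        Nat.mod_eq_of_lt (by omega)] at h
      have := hadj a (by omega)
      rwa [show a.val + 1 = b.val by omega] at this
    · rw [Nat.mod_eq_of_lt (by omega)] at h
      rw [show a.val = ℓ - 1 by omega, show b.val = 0 by omega]
      exact hclose
  refine ⟨fun a => f a, fun a b hab => ?_, fun a b hab => ?_⟩
  · by_contra hne
    rcases lt_or_gt_of_ne (fun h => hne (Fin.ext h)) with h | h
    · exact hinj _ _ h b.isLt hab
    · exact hinj _ _ h a.isLt hab.symm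
  · rw [SimpleGraph.cycleGraph_adj'] at hab
    rcases hab with h | h
    · exact (key b a h).symm
    · exact key a b h

lemma iterate_mem_level {V : Type*} (S : ℕ → Set V) (par : V → V)
    (hpar : ∀ a, ∀ x ∈ S (a + 1), par x ∈ S a) (i : ℕ) :
    ∀ t, ∀ x ∈ S i, t ≤ i → par^[t] x ∈ S (i - t) := by
  intro t x hx
  induction t with
  | zero => simpa using hx
  | succ t ih =>
    intro ht
    rw [Function.iterate_succ_apply']
    refine hpar _ _ ?_
    rw [show i - (t + 1) + 1 = i - t by omega]
    exact ih (by omega)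

/-- A chain of adjacent vertices in one level of a rooted forest, whose ancestors at height `h` are
strictly increasing and whose ancestors at height `h + 1` agree, closes up to a cycle. -/
lemma containsCopy_of_chain {V : Type*} [LinearOrder V] (H : SimpleGraph V) (S : ℕ → Set V)
    (par : V → V) (hdisj : ∀ a b x, x ∈ S a → x ∈ S b → a = b)
    (hpar : ∀ a, ∀ x ∈ S (a + 1), par x ∈ S a ∧ H.Adj x (par x))
    (i h ℓ m : ℕ) (hi : h + 1 ≤ i) (hm : m + 2 * (h + 1) = ℓ) (hm1 : 1 ≤ m) (p : ℕ → V)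
    (hS : ∀ t ≤ m, p t ∈ S i) (hadj : ∀ t < m, H.Adj (p t) (p (t + 1)))
    (heq : ∀ t < m, par^[h + 1] (p t) = par^[h + 1] (p (t + 1)))
    (hlt : ∀ t < m, par^[h] (p t) < par^[h] (p (t + 1))) :
    ContainsCopy (SimpleGraph.cycleGraph ℓ) H := by
  have hlev := iterate_mem_level S par (fun a x hx => (hpar a x hx).1) i
  have hup : ∀ t, ∀ x ∈ S i, t + 1 ≤ i → H.Adj (par^[t] x) (par^[t + 1] x) := by
    intro t x hx ht
    rw [Function.iterate_succ_apply']
    refine (hpar (i - (t + 1)) _ ?_).2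
    rw [show i - (t + 1) + 1 = i - t by omega]
    exact hlev t x hx (by omega)
  have hmono : ∀ a b, a < b → b ≤ m → par^[h] (p a) < par^[h] (p b) := by
    intro a b hab
    induction b, hab using Nat.le_induction with
    | base => exact fun hb => hlt a (by omega)
    | succ b hab ih => exact fun hb => (ih (by omega)).trans (hlt b (by omega))
  have htop : ∀ b ≤ m, par^[h + 1] (p 0) = par^[h + 1] (p b) := by
    intro b
    induction b with
    | zero => simp
    | succ b ih => exact fun hb => (ih (by omega)).trans (heq b (by omega))
  have hsep : ∀ t ≤ h, par^[t] (p m) ≠ par^[t] (p 0) := by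
    intro t ht he
    have := hmono 0 m (by omega) le_rfl
    rw [show h = (h - t) + t by omega, Function.iterate_add_apply, Function.iterate_add_apply,
      he] at this
    exact lt_irrefl _ this
  have h0 := hS 0 (by omega)
  have hmS := hS m le_rfl
  let f : ℕ → V := fun s => if s ≤ m then p s else
    if s ≤ m + (h + 1) then par^[s - m] (p m) else par^[ℓ - s] (p 0)
  have f1 : ∀ s, s ≤ m → f s = p s := fun s hs => if_pos hs
  have f2 : ∀ s, m < s → s ≤ m + (h + 1) → f s = par^[s - m] (p m) := fun s hs hs' => by
    simp only [f]; rw [if_neg (by omega), if_pos hs']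
  have f3 : ∀ s, m + (h + 1) < s → f s = par^[ℓ - s] (p 0) := fun s hs => by
    simp only [f]; rw [if_neg (by omega), if_neg (by omega)]
  apply containsCopy_cycleGraph H ℓ f
  · intro a b hab hb he
    by_cases hbm : b ≤ m
    · rw [f1 a (by omega), f1 b hbm] at he
      exact (hmono a b hab hbm).ne (by rw [he])
    by_cases hb2 : b ≤ m + (h + 1)
    · rw [f2 b (by omega) hb2] at he
      have hbl := hlev (b - m) _ hmS (by omega)
      rw [← he] at hbl
      by_cases ham : a ≤ m
      · rw [f1 a ham] at hbl
        have := hdisj _ _ _ hbl (hS a ham)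
        omega
      · rw [f2 a (by omega) (by omega)] at hbl
        have := hdisj _ _ _ hbl (hlev (a - m) _ hmS (by omega))
        omega
    · rw [f3 b (by omega)] at he
      have hbl := hlev (ℓ - b) _ h0 (by omega)
      rw [← he] at hbl
      by_cases ham : a ≤ m
      · rw [f1 a ham] at hbl
        have := hdisj _ _ _ hbl (hS a ham)
        omega
      by_cases ha2 : a ≤ m + (h + 1)
      · rw [f2 a (by omega) ha2] at hbl he
        have := hdisj _ _ _ hbl (hlev (a - m) _ hmS (by omega))
        have hab' : a - m = ℓ - b := by omega
        rw [← hab'] at he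
        exact hsep _ (by omega) he
      · rw [f3 a (by omega)] at hbl
        have := hdisj _ _ _ hbl (hlev (ℓ - a) _ h0 (by omega))
        omega
  · intro a ha
    by_cases h1 : a < m
    · rw [f1 a h1.le, f1 (a + 1) h1]
      exact hadj a h1
    by_cases h2 : a = m
    · subst h2
      rw [f1 a le_rfl, f2 (a + 1) (by omega) (by omega), Nat.add_sub_cancel_left]
      exact hup 0 _ hmS (by omega)
    by_cases h3 : a + 1 ≤ m + (h + 1)
    · rw [f2 a (by omega) (by omega), f2 (a + 1) (by omega) h3,
        show a + 1 - m = a - m + 1 by omega]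
      exact hup _ _ hmS (by omega)
    · have hfa : f a = par^[ℓ - (a + 1) + 1] (p 0) := by
        by_cases h4 : a = m + (h + 1)
        · rw [f2 a (by omega) (by omega), show a - m = h + 1 by omega,
            show ℓ - (a + 1) + 1 = h + 1 by omega, htop m le_rfl]
        · rw [f3 a (by omega), show ℓ - (a + 1) + 1 = ℓ - a by omega]
      rw [hfa, f3 (a + 1) (by omega)]
      exact (hup _ _ h0 (by omega)).symm
  · have hfl : f (ℓ - 1) = par^[0 + 1] (p 0) := by
      by_cases h4 : h = 0
      · subst h4
        rw [f2 (ℓ - 1) (by omega) (by omega), show ℓ - 1 - m = 0 + 1 by omega, htop m le_rfl]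
      · rw [f3 (ℓ - 1) (by omega), show ℓ - (ℓ - 1) = 0 + 1 by omega]
    rw [hfl, f1 0 (by omega)]
    exact (hup 0 _ h0 (by omega)).symm

/-- In a graph without `C_ℓ`, the `i`-th level of a rooted tree is `ℓ ^ i`-colourable when
`2 * i < ℓ`. -/
lemma exists_coloring_level {V : Type*} [LinearOrder V] (H : SimpleGraph V) (S : ℕ → Set V)
    (par : V → V) (hdisj : ∀ a b x, x ∈ S a → x ∈ S b → a = b)
    (hpar : ∀ a, ∀ x ∈ S (a + 1), par x ∈ S a ∧ H.Adj x (par x))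
    (hroot : (S 0).Subsingleton) (ℓ i : ℕ) (hi : 2 * i < ℓ)
    (hfree : ¬ ContainsCopy (SimpleGraph.cycleGraph ℓ) H) :
    ∃ c : V → (Fin i → Fin ℓ), ∀ x ∈ S i, ∀ y ∈ S i, H.Adj x y → c x ≠ c y := by
  let R : ℕ → V → V → Prop := fun h x y => x ∈ S i ∧ y ∈ S i ∧ H.Adj x y ∧
    par^[h + 1] x = par^[h + 1] y ∧ par^[h] x < par^[h] y
  have hcol : ∀ h : Fin i, ∃ c : V → Fin ℓ, ∀ x y, R h x y → c x ≠ c y := by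
    intro h
    apply exists_coloring_of_no_chain
    rintro ⟨p, hp⟩
    have hh := h.isLt
    refine hfree (containsCopy_of_chain H S par hdisj hpar i h ℓ (ℓ - 2 * (h + 1)) hh
      (by omega) (by omega) p (fun t ht => (hp t (by omega)).1)
      (fun t ht => (hp t (by omega)).2.2.1) (fun t ht => (hp t (by omega)).2.2.2.1)
      (fun t ht => (hp t (by omega)).2.2.2.2))
  choose c hc using hcol
  refine ⟨fun x h => c h x, fun x hx y hy hxy he => ?_⟩
  have hlev := iterate_mem_level S par (fun a x hx => (hpar a x hx).1) i
  have hex : ∃ t, par^[t] x = par^[t] y := by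
    refine ⟨i, hroot ?_ ?_⟩
    · simpa using hlev i x hx le_rfl
    · simpa using hlev i y hy le_rfl
  classical
  obtain ⟨t, ht, htmin⟩ : ∃ t, par^[t] x = par^[t] y ∧ ∀ s < t, par^[s] x ≠ par^[s] y :=
    ⟨Nat.find hex, Nat.find_spec hex, fun s hs => Nat.find_min hex hs⟩
  have hti : t ≤ i := by
    by_contra! hlt
    refine htmin i hlt (hroot ?_ ?_)
    · simpa using hlev i x hx le_rfl
    · simpa using hlev i y hy le_rfl
  rcases t with _ | h
  · exact hxy.ne ht
  · have hh := congrFun he ⟨h, hti⟩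
    rcases lt_or_gt_of_ne (htmin h (by omega)) with hl | hl
    · exact hc ⟨h, hti⟩ x y ⟨hx, hy, hxy, ht, hl⟩ hh
    · exact hc ⟨h, hti⟩ y x ⟨hy, hx, hxy.symm, ht.symm, hl⟩ hh.symm

/-- The endpoints of walks of length `i` from `v` all of whose later vertices lie in `W`. -/
def walkEnds {V : Type*} (H : SimpleGraph V) (W : Set V) (v : V) : ℕ → Set V
  | 0 => {v}
  | i + 1 => {x | x ∈ W ∧ ∃ y ∈ walkEnds H W v i, H.Adj y x}

/-- The breadth-first-search levels from `v` within `W`. -/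
def bfsLevel {V : Type*} (H : SimpleGraph V) (W : Set V) (v : V) (i : ℕ) : Set V :=
  {x | x ∈ walkEnds H W v i ∧ ∀ j < i, x ∉ walkEnds H W v j}

section Levels

variable {V : Type*} {H : SimpleGraph V} {W : Set V} {v : V}

lemma bfsLevel_zero : bfsLevel H W v 0 = {v} := by
  ext x
  simp [bfsLevel, walkEnds]

lemma bfsLevel_subset (hv : v ∈ W) (i : ℕ) : bfsLevel H W v i ⊆ W := by
  rintro x ⟨hx, -⟩
  cases i with
  | zero => rwa [show x = v from hx]
  | succ i => exact hx.1

lemma eq_of_mem_bfsLevel (a b : ℕ) (x : V) (ha : x ∈ bfsLevel H W v a)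
    (hb : x ∈ bfsLevel H W v b) : a = b := by
  rcases lt_trichotomy a b with h | h | h
  · exact (hb.2 a h ha.1).elim
  · exact h
  · exact (ha.2 b h hb.1).elim

lemma exists_parent (a : ℕ) (x : V) (hx : x ∈ bfsLevel H W v (a + 1)) :
    ∃ y ∈ bfsLevel H W v a, H.Adj x y := by
  obtain ⟨⟨hxW, y, hy, hyx⟩, hmin⟩ := hx
  exact ⟨y, ⟨hy, fun j hj hyj => hmin (j + 1) (by omega) ⟨hxW, y, hyj, hyx⟩⟩, hyx.symm⟩

lemma adj_bfsLevel (hv : v ∈ W) {i : ℕ} {x y : V} (hx : x ∈ bfsLevel H W v i) (hy : y ∈ W)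
    (hxy : H.Adj x y) :
    y ∈ bfsLevel H W v (i - 1) ∨ y ∈ bfsLevel H W v i ∨ y ∈ bfsLevel H W v (i + 1) := by
  classical
  have hex : ∃ j, y ∈ walkEnds H W v j := ⟨i + 1, hy, x, hx.1, hxy⟩
  obtain ⟨j, hj, hmin⟩ : ∃ j, y ∈ walkEnds H W v j ∧ ∀ s < j, y ∉ walkEnds H W v s :=
    ⟨Nat.find hex, Nat.find_spec hex, fun s hs => Nat.find_min hex hs⟩
  have hji : j ≤ i + 1 := by
    by_contra! h
    exact hmin (i + 1) h ⟨hy, x, hx.1, hxy⟩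
  have hij : i ≤ j + 1 := by
    by_contra! h
    exact hx.2 (j + 1) h ⟨bfsLevel_subset hv i hx, y, hj, hxy.symm⟩
  have hyj : y ∈ bfsLevel H W v j := ⟨hj, hmin⟩
  rcases (by omega : j = i - 1 ∨ j = i ∨ j = i + 1) with rfl | rfl | rfl
  · exact Or.inl hyj
  · exact Or.inr (Or.inl hyj)
  · exact Or.inr (Or.inr hyj)

end Levels

/-- A nonempty vertex set `W` in a `C_ℓ`-free graph contains a nonempty independent set whose closed
neighbourhood in `W` is larger by a factor of at most `3 * ℓ ^ k * q`, when `|W| ≤ q ^ k`. -/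
lemma exists_indep_small_nbhd {V : Type*} [Fintype V] [LinearOrder V] (H : SimpleGraph V)
    (ℓ k : ℕ) (hk : 2 * k ≤ ℓ + 1) (hk1 : 1 ≤ k)
    (hfree : ¬ ContainsCopy (SimpleGraph.cycleGraph ℓ) H)
    (W : Finset V) (hW : W.Nonempty) (q : ℝ) (hq : 1 ≤ q) (hWq : (#W : ℝ) ≤ q ^ k) :
    ∃ I N : Finset V, I.Nonempty ∧ I ⊆ N ∧ N ⊆ W ∧ (∀ x ∈ I, ∀ y ∈ I, ¬ H.Adj x y) ∧
      (∀ x ∈ I, ∀ y ∈ W, H.Adj x y → y ∈ N) ∧ (#N : ℝ) ≤ 3 * (ℓ : ℝ) ^ k * q * #I := by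
  classical
  obtain ⟨v, hv⟩ := hW
  have hvW : v ∈ (W : Set V) := hv
  let S : ℕ → Finset V := fun i => (bfsLevel H W v i).toFinset
  have hSW : ∀ i, S i ⊆ W := fun i x hx =>
    bfsLevel_subset hvW i (Set.mem_toFinset.1 hx)
  have hS0 : #(S 0) = 1 := by simp [S, bfsLevel_zero]
  have hex : ∃ i, i < k ∧ (#(S (i + 1)) : ℝ) ≤ q * #(S i) := by
    by_contra! hcon
    have hgrow : ∀ i ≤ k, q ^ i ≤ (#(S i) : ℝ) ∧ (1 ≤ i → q ^ i < (#(S i) : ℝ)) := by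
      intro i
      induction i with
      | zero => simp [hS0]
      | succ i ih =>
        intro hi
        have h1 := (ih (by omega)).1
        have h2 := hcon i (by omega)
        have h3 : q ^ (i + 1) < (#(S (i + 1)) : ℝ) := by
          rw [pow_succ']
          exact lt_of_le_of_lt (by gcongr) h2
        exact ⟨h3.le, fun _ => h3⟩
    have h1 := (hgrow k le_rfl).2 hk1
    have h2 : (#(S k) : ℝ) ≤ #W := by exact_mod_cast card_le_card (hSW k)
    linarith
  obtain ⟨i, ⟨hik, hi⟩, hmin⟩ : ∃ i, (i < k ∧ (#(S (i + 1)) : ℝ) ≤ q * #(S i)) ∧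
      ∀ j < i, ¬ (j < k ∧ (#(S (j + 1)) : ℝ) ≤ q * #(S j)) :=
    ⟨Nat.find hex, Nat.find_spec hex, fun s hs => Nat.find_min hex hs⟩
  have hgrow : ∀ j ≤ i, 1 ≤ #(S j) ∧ #(S (j - 1)) ≤ #(S j) := by
    intro j
    induction j with
    | zero => simp [hS0]
    | succ j ih =>
      intro hj
      have h1 := hmin j (by omega)
      push Not at h1
      have h2 := h1 (by omega)
      have h3 : (#(S j) : ℝ) ≤ #(S (j + 1)) :=
        (le_mul_of_one_le_left (by positivity) hq).trans h2.le
      have h4 : #(S j) ≤ #(S (j + 1)) := by exact_mod_cast h3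
      exact ⟨(ih (by omega)).1.trans h4, h4⟩
  have hpar : ∃ par : V → V, ∀ a, ∀ x ∈ bfsLevel H W v (a + 1),
      par x ∈ bfsLevel H W v a ∧ H.Adj x (par x) := by
    have : ∀ x, ∃ y, ∀ a, x ∈ bfsLevel H W v (a + 1) → y ∈ bfsLevel H W v a ∧ H.Adj x y := by
      intro x
      by_cases h : ∃ a, x ∈ bfsLevel H W v (a + 1)
      · obtain ⟨a, ha⟩ := h
        obtain ⟨y, hy, hxy⟩ := exists_parent a x ha
        refine ⟨y, fun b hb => ?_⟩
        have := eq_of_mem_bfsLevel _ _ x ha hb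
        obtain rfl : a = b := by omega
        exact ⟨hy, hxy⟩
      · exact ⟨x, fun a ha => (h ⟨a, ha⟩).elim⟩
    choose par hpar using this
    exact ⟨par, fun a x hx => hpar x a hx⟩
  obtain ⟨par, hpar⟩ := hpar
  obtain ⟨c, hc⟩ := exists_coloring_level H (bfsLevel H W v) par eq_of_mem_bfsLevel hpar
    (by rw [bfsLevel_zero]; exact Set.subsingleton_singleton) ℓ i (by omega) hfree
  have hℓ : 1 ≤ ℓ := by omega
  obtain ⟨b, hb⟩ : ∃ b, #(S i) ≤ ℓ ^ i * #{x ∈ S i | c x = b} := by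
    by_contra! hcon
    have : Nonempty (Fin i → Fin ℓ) := ⟨fun _ => ⟨0, hℓ⟩⟩
    have h1 := card_eq_sum_card_fiberwise (f := c) (s := S i) (t := univ) (by simp)
    have h2 : ∑ b, ℓ ^ i * #{x ∈ S i | c x = b} < ∑ _b : Fin i → Fin ℓ, #(S i) :=
      sum_lt_sum_of_nonempty univ_nonempty fun b _ => hcon b
    rw [← mul_sum, ← h1] at h2
    simp at h2
  let I : Finset V := {x ∈ S i | c x = b}
  have hIS : ∀ x ∈ I, x ∈ S i := fun x hx => (mem_filter.1 hx).1
  have hIpos : I.Nonempty := by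
    rw [← card_pos]
    by_contra! h0
    have h1 := (hgrow i le_rfl).1
    have h2 : #I = 0 := by omega
    simp only [I] at h2
    rw [h2] at hb
    omega
  refine ⟨I, S (i - 1) ∪ S i ∪ S (i + 1), hIpos, ?_, ?_, ?_, ?_, ?_⟩
  · intro x hx
    simp [hIS x hx]
  · exact union_subset (union_subset (hSW _) (hSW _)) (hSW _)
  · intro x hx y hy hxy
    refine hc x (Set.mem_toFinset.1 (hIS x hx)) y (Set.mem_toFinset.1 (hIS y hy)) hxy ?_
    rw [(mem_filter.1 hx).2, (mem_filter.1 hy).2]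
  · intro x hx y hy hxy
    have := adj_bfsLevel hvW (Set.mem_toFinset.1 (hIS x hx)) (mem_coe.2 hy) hxy
    simp only [mem_union, S, Set.mem_toFinset]
    tauto
  · have h1 : (#(S (i - 1) ∪ S i ∪ S (i + 1)) : ℝ) ≤ #(S (i - 1)) + #(S i) + #(S (i + 1)) := by
      exact_mod_cast (card_union_le _ _).trans (Nat.add_le_add_right (card_union_le _ _) _)
    have h2 : (#(S (i - 1)) : ℝ) ≤ #(S i) := by exact_mod_cast (hgrow i le_rfl).2
    have h3 : (#(S i) : ℝ) ≤ q * #(S i) := le_mul_of_one_le_left (by positivity) hq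
    have h4 : (#(S i) : ℝ) ≤ (ℓ : ℝ) ^ k * #I := by
      have h5 : (#(S i) : ℝ) ≤ (ℓ : ℝ) ^ i * #I := by exact_mod_cast hb
      refine h5.trans ?_
      gcongr
      exact_mod_cast hℓ
    have h6 : q * #(S i) ≤ q * ((ℓ : ℝ) ^ k * #I) := by gcongr
    nlinarith

/-- A vertex set `W` with `|W| ≤ q ^ k` in a `C_ℓ`-free graph contains an independent set of size
at least `|W| / (3 * ℓ ^ k * q)`. -/
lemma exists_large_indep {V : Type*} [Fintype V] [LinearOrder V] (H : SimpleGraph V)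
    (ℓ k : ℕ) (hk : 2 * k ≤ ℓ + 1) (hk1 : 1 ≤ k)
    (hfree : ¬ ContainsCopy (SimpleGraph.cycleGraph ℓ) H) (q : ℝ) (hq : 1 ≤ q)
    (W : Finset V) (hWq : (#W : ℝ) ≤ q ^ k) :
    ∃ I ⊆ W, (∀ x ∈ I, ∀ y ∈ I, ¬ H.Adj x y) ∧ (#W : ℝ) ≤ 3 * (ℓ : ℝ) ^ k * q * #I := by
  induction W using Finset.strongInduction with
  | H W ih =>
    rcases W.eq_empty_or_nonempty with rfl | hW
    · exact ⟨∅, by simp⟩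
    obtain ⟨I, N, hI, hIN, hNW, hind, hnb, hcard⟩ :=
      exists_indep_small_nbhd H ℓ k hk hk1 hfree W hW q hq hWq
    have hlt : W \ N ⊂ W := sdiff_ssubset hNW (hI.mono hIN)
    obtain ⟨J, hJ, hJind, hJcard⟩ := ih (W \ N) hlt
      (le_trans (by exact_mod_cast card_le_card hlt.1) hWq)
    have hIJ : Disjoint I J := by
      rw [disjoint_left]
      exact fun x hx hx' => (mem_sdiff.1 (hJ hx')).2 (hIN hx)
    have hno : ∀ x ∈ I, ∀ y ∈ J, ¬ H.Adj x y := fun x hx y hy hxy =>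
      (mem_sdiff.1 (hJ hy)).2 (hnb x hx y (mem_sdiff.1 (hJ hy)).1 hxy)
    refine ⟨I ∪ J, union_subset (hIN.trans hNW) (hJ.trans sdiff_subset), ?_, ?_⟩
    · intro x hx y hy hxy
      rcases mem_union.1 hx with hx | hx <;> rcases mem_union.1 hy with hy | hy
      · exact hind x hx y hy hxy
      · exact hno x hx y hy hxy
      · exact hno y hy x hx hxy.symm
      · exact hJind x hx y hy hxy
    · have h1 : (#W : ℝ) = #(W \ N) + #N := by exact_mod_cast (card_sdiff_add_card_eq_card hNW).symm
      rw [card_union_of_disjoint hIJ, h1]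
      push_cast
      linarith

/-- A vertex set `W` in a `C_ℓ`-free graph can be properly coloured with `O(|W| ^ (1 / k))`
colours. -/
lemma exists_coloring_rpow {V : Type*} [Fintype V] [LinearOrder V] (H : SimpleGraph V)
    (ℓ k : ℕ) (hk : 2 * k ≤ ℓ + 1) (hk1 : 1 ≤ k)
    (hfree : ¬ ContainsCopy (SimpleGraph.cycleGraph ℓ) H) (W : Finset V) :
    ∃ (m : ℕ) (c : V → ℕ), (m : ℝ) ≤ 3 * (ℓ : ℝ) ^ k * k * (#W : ℝ) ^ ((1 : ℝ) / k) ∧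
      (∀ x ∈ W, c x < m) ∧ ∀ x ∈ W, ∀ y ∈ W, H.Adj x y → c x ≠ c y := by
  induction W using Finset.strongInduction with
  | H W ih =>
    rcases W.eq_empty_or_nonempty with rfl | hW
    · exact ⟨0, fun _ => 0, by simp; positivity⟩
    have hk0 : (0 : ℝ) < k := by exact_mod_cast hk1
    have hℓ0 : (0 : ℝ) < ℓ := by exact_mod_cast (by omega : 0 < ℓ)
    have hw1 : (1 : ℝ) ≤ #W := by exact_mod_cast hW.card_pos
    have hq : (1 : ℝ) ≤ (#W : ℝ) ^ ((1 : ℝ) / k) := Real.one_le_rpow hw1 (by positivity)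
    have hqk : ((#W : ℝ) ^ ((1 : ℝ) / k)) ^ k = #W := by
      rw [one_div, Real.rpow_inv_natCast_pow (by positivity) (by omega)]
    obtain ⟨I, hIW, hind, hcard⟩ := exists_large_indep H ℓ k hk hk1 hfree _ hq W hqk.ge
    set q := (#W : ℝ) ^ ((1 : ℝ) / k) with hqdef
    have hIne : I.Nonempty := by
      rw [nonempty_iff_ne_empty]
      rintro rfl
      simp at hcard
      exact hW.ne_empty hcard
    obtain ⟨m, c, hm, hcm, hc⟩ := ih (W \ I) (sdiff_ssubset hIW hIne)
    refine ⟨m + 1, fun x => if x ∈ I then m else c x, ?_, ?_, ?_⟩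
    · have hs : (#(W \ I) : ℝ) = #W * (1 + -(#I / #W : ℝ)) := by
        have h1 : (#W : ℝ) = #(W \ I) + #I := by
          exact_mod_cast (card_sdiff_add_card_eq_card hIW).symm
        field_simp
        linarith
      have hIle : (#I : ℝ) / #W ≤ 1 := by
        rw [div_le_one (by linarith)]
        exact_mod_cast card_le_card hIW
      have hb := rpow_one_add_le_one_add_mul_self (s := -(#I / #W : ℝ)) (p := (1 : ℝ) / k)
        (by linarith) (by positivity)
        (by rw [div_le_one hk0]; exact_mod_cast hk1)
      rw [hs, Real.mul_rpow (by positivity) (by linarith), ← hqdef] at hm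
      have h2 : 3 * (ℓ : ℝ) ^ k * k * (q * (1 + -(#I / #W : ℝ)) ^ ((1 : ℝ) / k)) ≤
          3 * (ℓ : ℝ) ^ k * k * (q * (1 + 1 / k * -(#I / #W : ℝ))) := by gcongr
      have h3 : 3 * (ℓ : ℝ) ^ k * k * (q * (1 + 1 / k * -(#I / #W : ℝ))) =
          3 * (ℓ : ℝ) ^ k * k * q - 3 * (ℓ : ℝ) ^ k * q * #I / #W := by
        field_simp
        ring
      have h4 : 1 ≤ 3 * (ℓ : ℝ) ^ k * q * #I / #W := by
        rwa [one_le_div (by linarith)]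
      push_cast
      linarith
    · intro x hx
      by_cases hxI : x ∈ I
      · simp [hxI]
      · have := hcm x (mem_sdiff.2 ⟨hx, hxI⟩)
        simp only [hxI, if_false]
        omega
    · intro x hx y hy hxy
      by_cases hxI : x ∈ I <;> by_cases hyI : y ∈ I
      · exact (hind x hxI y hyI hxy).elim
      · have := hcm y (mem_sdiff.2 ⟨hy, hyI⟩)
        simp only [hxI, hyI, if_true, if_false]
        omega
      · have := hcm x (mem_sdiff.2 ⟨hx, hxI⟩)
        simp only [hxI, hyI, if_true, if_false]
        omega
      · simp only [hxI, hyI, if_false]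
        exact hc x (mem_sdiff.2 ⟨hx, hxI⟩) y (mem_sdiff.2 ⟨hy, hyI⟩) hxy

/-- The minrank of a graph is at most the number of colours of a proper colouring of its
complement. -/
lemma minrk_le_of_coloring (F : Type*) [Field F] {V : Type*} [Fintype V] (G : SimpleGraph V)
    (m : ℕ) (c : V → Fin m) (hc : ∀ x y, Gᶜ.Adj x y → c x ≠ c y) : minrk F G ≤ m := by
  classical
  let A : Matrix V (Fin m) F := Matrix.of fun x a => if c x = a then 1 else 0
  have hA : ∀ x y, (A * Aᵀ) x y = if c x = c y then 1 else 0 := by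
    intro x y
    simp [A, Matrix.mul_apply, @eq_comm _ (c y)]
  have hrep : Represents (A * Aᵀ) G := by
    refine ⟨fun x => by simp [hA], fun x y hxy hadj => ?_⟩
    rw [hA, if_neg]
    exact hc x y ((SimpleGraph.compl_adj G x y).2 ⟨hxy, hadj⟩)
  have hle : minrk F G ≤ (A * Aᵀ).rank := Nat.sInf_le ⟨_, hrep, rfl⟩
  exact hle.trans ((Matrix.rank_mul_le_left _ _).trans (by simpa using A.rank_le_card_width))

/-- For every ℓ ≥ 3 there is c > 0 such that for every field F and n ≥ 1, every
n-vertex graph G whose complement is C_ℓ-free satisfies minrk_F(G) ≤ c · n^{1/k}, k = ⌈ℓ/2⌉. -/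
theorem minrk_le_of_compl_cycle_free (ℓ : ℕ) (hl : 3 ≤ ℓ) :
    ∃ c : ℝ, 0 < c ∧ ∀ (F : Type) [Field F], ∀ n : ℕ, 1 ≤ n →
      ∀ G : SimpleGraph (Fin n), ¬ ContainsCopy (SimpleGraph.cycleGraph ℓ) Gᶜ →
        (minrk F G : ℝ) ≤ c * (n : ℝ) ^ ((1 : ℝ) / ((ℓ + 1) / 2 : ℕ)) := by
  have hℓ0 : (0 : ℝ) < ℓ := by exact_mod_cast (by omega : 0 < ℓ)
  have hk0 : (0 : ℝ) < ((ℓ + 1) / 2 : ℕ) := by exact_mod_cast (by omega : 0 < (ℓ + 1) / 2)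
  refine ⟨3 * (ℓ : ℝ) ^ ((ℓ + 1) / 2) * ((ℓ + 1) / 2 : ℕ), by positivity, ?_⟩
  intro F _ n _ G hfree
  obtain ⟨m, c, hm, hcm, hc⟩ := exists_coloring_rpow Gᶜ ℓ ((ℓ + 1) / 2) (by omega) (by omega)
    hfree univ
  have h := minrk_le_of_coloring F G m (fun x => ⟨c x, hcm x (mem_univ x)⟩) fun x y hxy he =>
    hc x (mem_univ x) y (mem_univ y) hxy (Fin.mk.inj he)
  rw [card_univ, Fintype.card_fin] at hm
  exact (Nat.cast_le.2 h).trans hm
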